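/- arXiv:0901.4746 — 8 statements merged into one kernel-verified Lean document; each statement's English description precedes it below -/
import Mathlib

section
/- Let g = sl_n(ℂ) (n ≥ 2) and let r : g → g be the operator r(X) = X₋ − X₊ (strictly lower part minus strictly upper part). Define the bilinear bracket [X,Y]_* = ½([rX, Y] + [X, rY]) on g, and set r_± = ½(r ± id). Then: (1) [·,·]_* is a Lie bracket on g (it is bilinear, antisymmetric, and satisfies the Jacobi identity); and (2) the maps r_± : (g, [·,·]_*) → (g, [·,·]) are Lie algebra homomorphisms, i.e. r_±([X,Y]_*) = [r_±X, r_±Y] for all X, Y ∈ g. -/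
open Matrix

/-- The strictly lower-triangular part `X₋` of a matrix. -/
noncomputable def strictLower {n : ℕ} (X : Matrix (Fin n) (Fin n) ℂ) : Matrix (Fin n) (Fin n) ℂ :=
  fun i j => if j < i then X i j else 0

/-- The strictly upper-triangular part `X₊` of a matrix. -/
noncomputable def strictUpper {n : ℕ} (X : Matrix (Fin n) (Fin n) ℂ) : Matrix (Fin n) (Fin n) ℂ :=
  fun i j => if i < j then X i j else 0

/-- The classical r-matrix `r X = X₋ - X₊` on `sl_n(ℂ)`. -/
noncomputable def rMat {n : ℕ} (X : Matrix (Fin n) (Fin n) ℂ) : Matrix (Fin n) (Fin n) ℂ :=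
  strictLower X - strictUpper X

/-- The commutator bracket `[X, Y] = XY - YX`. -/
noncomputable def matComm {n : ℕ} (X Y : Matrix (Fin n) (Fin n) ℂ) : Matrix (Fin n) (Fin n) ℂ :=
  X * Y - Y * X

/-- The dual Lie bracket `[X,Y]_* = ½([rX, Y] + [X, rY])`. -/
noncomputable def bstar {n : ℕ} (X Y : Matrix (Fin n) (Fin n) ℂ) : Matrix (Fin n) (Fin n) ℂ :=
  (1 / 2 : ℂ) • (matComm (rMat X) Y + matComm X (rMat Y))

/-- `r₊ = ½(r + id)`. -/
noncomputable def rplus {n : ℕ} (X : Matrix (Fin n) (Fin n) ℂ) : Matrix (Fin n) (Fin n) ℂ :=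
  (1 / 2 : ℂ) • (rMat X + X)

/-- `r₋ = ½(r - id)`. -/
noncomputable def rminus {n : ℕ} (X : Matrix (Fin n) (Fin n) ℂ) : Matrix (Fin n) (Fin n) ℂ :=
  (1 / 2 : ℂ) • (rMat X - X)

section Auxiliary

variable {n : ℕ}

/-- If `A` is strictly lower and `B` weakly lower triangular, `A * B` is strictly lower. -/
lemma mul_strictLower_of_left {A B : Matrix (Fin n) (Fin n) ℂ}
    (hA : ∀ i j, i ≤ j → A i j = 0) (hB : ∀ i j, i < j → B i j = 0) (i j : Fin n)
    (hij : i ≤ j) : (A * B) i j = 0 := by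
  rw [Matrix.mul_apply]
  refine Finset.sum_eq_zero fun k _ => ?_
  rcases le_or_gt i k with h | h
  · rw [hA i k h, zero_mul]
  · rw [hB k j (h.trans_le hij), mul_zero]

/-- If `A` is weakly lower and `B` strictly lower triangular, `A * B` is strictly lower. -/
lemma mul_strictLower_of_right {A B : Matrix (Fin n) (Fin n) ℂ}
    (hA : ∀ i j, i < j → A i j = 0) (hB : ∀ i j, i ≤ j → B i j = 0) (i j : Fin n)
    (hij : i ≤ j) : (A * B) i j = 0 := by
  rw [Matrix.mul_apply]
  refine Finset.sum_eq_zero fun k _ => ?_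
  rcases lt_or_ge i k with h | h
  · rw [hA i k h, zero_mul]
  · rw [hB k j (h.trans hij), mul_zero]

lemma rMat_add (X Y : Matrix (Fin n) (Fin n) ℂ) : rMat (X + Y) = rMat X + rMat Y := by
  ext i j
  simp only [rMat, strictLower, strictUpper, Matrix.add_apply, Matrix.sub_apply]
  split_ifs <;> ring

lemma rMat_smul (c : ℂ) (X : Matrix (Fin n) (Fin n) ℂ) : rMat (c • X) = c • rMat X := by
  ext i j
  simp only [rMat, strictLower, strictUpper, Matrix.smul_apply, Matrix.sub_apply, smul_eq_mul]
  split_ifs <;> ring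

lemma rMat_transpose (X : Matrix (Fin n) (Fin n) ℂ) : rMat Xᵀ = -(rMat X)ᵀ := by
  ext i j
  simp only [rMat, strictLower, strictUpper, Matrix.sub_apply, Matrix.neg_apply,
    Matrix.transpose_apply]
  split_ifs <;> ring

lemma rMat_of_strictLower {A : Matrix (Fin n) (Fin n) ℂ} (hA : ∀ i j, i ≤ j → A i j = 0) :
    rMat A = A := by
  ext i j
  simp only [rMat, strictLower, strictUpper, Matrix.sub_apply]
  rcases lt_or_ge j i with h | h
  · simp [h, h.not_gt]
  · simp [hA i j h]

/-- `r` fixes the commutators of strictly lower with weakly lower triangular matrices. -/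
lemma rMat_lower_comm {L L' D D' : Matrix (Fin n) (Fin n) ℂ}
    (hL : ∀ i j, i ≤ j → L i j = 0) (hL' : ∀ i j, i ≤ j → L' i j = 0)
    (hD : ∀ i j, i < j → D i j = 0) (hD' : ∀ i j, i < j → D' i j = 0) :
    rMat (matComm L (L' + D') + matComm (L + D) L') =
      matComm L (L' + D') + matComm (L + D) L' := by
  have h : ∀ i j, i < j → (L + D) i j = 0 := fun i j hij => by
    simp [hL i j hij.le, hD i j hij]
  have h' : ∀ i j, i < j → (L' + D') i j = 0 := fun i j hij => by
    simp [hL' i j hij.le, hD' i j hij]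
  refine rMat_of_strictLower fun i j hij => ?_
  simp only [matComm, Matrix.add_apply, Matrix.sub_apply]
  rw [mul_strictLower_of_left hL h' i j hij, mul_strictLower_of_right h' hL i j hij,
    mul_strictLower_of_right h hL' i j hij, mul_strictLower_of_left hL' h i j hij]
  ring

lemma matComm_transpose (X Y : Matrix (Fin n) (Fin n) ℂ) :
    (matComm X Y)ᵀ = -matComm Xᵀ Yᵀ := by
  simp [matComm, Matrix.transpose_sub, Matrix.transpose_mul]

/-- `r` negates the commutators of strictly upper with weakly upper triangular matrices. -/
lemma rMat_upper_comm {U U' D D' : Matrix (Fin n) (Fin n) ℂ}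
    (hU : ∀ i j, j ≤ i → U i j = 0) (hU' : ∀ i j, j ≤ i → U' i j = 0)
    (hD : ∀ i j, j < i → D i j = 0) (hD' : ∀ i j, j < i → D' i j = 0) :
    rMat (matComm U (U' + D') + matComm (U + D) U') =
      -(matComm U (U' + D') + matComm (U + D) U') := by
  have h := rMat_lower_comm (L := Uᵀ) (L' := U'ᵀ) (D := Dᵀ) (D' := D'ᵀ)
    (fun i j => hU j i) (fun i j => hU' j i) (fun i j => hD j i) (fun i j => hD' j i)
  have e : matComm Uᵀ (U'ᵀ + D'ᵀ) + matComm (Uᵀ + Dᵀ) U'ᵀ =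
      (-1 : ℂ) • (matComm U (U' + D') + matComm (U + D) U')ᵀ := by
    simp only [Matrix.transpose_add, matComm_transpose]
    module
  rw [e, rMat_smul, rMat_transpose] at h
  have h2 := congrArg Matrix.transpose h
  simpa [add_comm] using h2

/-- The modified classical Yang–Baxter equation for `r`. -/
lemma rMat_modified_yangBaxter (X Y : Matrix (Fin n) (Fin n) ℂ) :
    rMat (matComm (rMat X) Y + matComm X (rMat Y)) =
      matComm (rMat X) (rMat Y) + matComm X Y := by
  have lower (X : Matrix (Fin n) (Fin n) ℂ) (i j : Fin n) (h : i ≤ j) :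
      strictLower X i j = 0 := if_neg h.not_gt
  have upper (X : Matrix (Fin n) (Fin n) ℂ) (i j : Fin n) (h : j ≤ i) :
      strictUpper X i j = 0 := if_neg h.not_gt
  have diag (X : Matrix (Fin n) (Fin n) ℂ) :
      ∃ D : Matrix (Fin n) (Fin n) ℂ, X = strictLower X + D + strictUpper X ∧
        (∀ i j, i < j → D i j = 0) ∧ ∀ i j, j < i → D i j = 0 :=
    ⟨X - strictLower X - strictUpper X, by abel,
      fun i j h => by simp [strictLower, strictUpper, h, h.not_gt],
      fun i j h => by simp [strictLower, strictUpper, h, h.not_gt]⟩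
  obtain ⟨D, hX, hD₁, hD₂⟩ := diag X
  obtain ⟨D', hY, hD₁', hD₂'⟩ := diag Y
  have hl := rMat_lower_comm (lower X) (lower Y) hD₁ hD₁'
  have hu := rMat_upper_comm (upper X) (upper Y) hD₂ hD₂'
  have hDD : matComm D D' = 0 := by
    have hd {E : Matrix (Fin n) (Fin n) ℂ} (h₁ : ∀ i j, i < j → E i j = 0)
        (h₂ : ∀ i j, j < i → E i j = 0) : Matrix.diagonal E.diag = E := by
      ext i j
      rcases lt_trichotomy i j with h | rfl | h
      · rw [Matrix.diagonal_apply_ne _ h.ne, h₁ i j h]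
      · simp
      · rw [Matrix.diagonal_apply_ne _ h.ne', h₂ i j h]
    rw [← hd hD₁ hD₂, ← hd hD₁' hD₂', matComm, Matrix.diagonal_mul_diagonal,
      Matrix.diagonal_mul_diagonal, sub_eq_zero]
    simp only [mul_comm]
  have hrX : rMat X = strictLower X - strictUpper X := rfl
  have hrY : rMat Y = strictLower Y - strictUpper Y := rfl
  rw [hrX, hrY]
  generalize strictLower X = L at *
  generalize strictUpper X = U at *
  generalize strictLower Y = L' at *
  generalize strictUpper Y = U' at *
  have e : matComm (L - U) Y + matComm X (L' - U') =
      (matComm L (L' + D') + matComm (L + D) L') +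
        (-1 : ℂ) • (matComm U (U' + D') + matComm (U + D) U') := by
    rw [hX, hY, neg_one_smul]
    simp only [matComm]
    noncomm_ring
  rw [← neg_eq_zero] at hDD
  rw [e, rMat_add, rMat_smul, hl, hu, neg_one_smul, hX, hY, ← sub_eq_zero, ← hDD]
  simp only [matComm]
  noncomm_ring

lemma rMat_bstar (X Y : Matrix (Fin n) (Fin n) ℂ) :
    rMat (bstar X Y) = (1 / 2 : ℂ) • (matComm (rMat X) (rMat Y) + matComm X Y) := by
  rw [bstar, rMat_smul, rMat_modified_yangBaxter]

lemma bstar_bstar (X Y Z : Matrix (Fin n) (Fin n) ℂ) :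
    bstar (bstar X Y) Z =
      (1 / 4 : ℂ) • (matComm (matComm (rMat X) (rMat Y) + matComm X Y) Z +
        matComm (matComm (rMat X) Y + matComm X (rMat Y)) (rMat Z)) := by
  rw [bstar, rMat_bstar]
  simp only [bstar, matComm, smul_mul_assoc, mul_smul_comm]
  module

end Auxiliary

/-- The bracket `[X,Y]_* = ½([rX,Y] + [X,rY])` on `sl_n(ℂ)` is bilinear,
antisymmetric and satisfies the Jacobi identity, and `r₊, r₋` are Lie algebra homomorphisms
from `(sl_n, [·,·]_*)` to `(sl_n, [·,·])`. -/
theorem stmt_3 (n : ℕ) (hn : 2 ≤ n) :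
    (∀ X Y Z : Matrix (Fin n) (Fin n) ℂ, X.trace = 0 → Y.trace = 0 → Z.trace = 0 →
      bstar (X + Y) Z = bstar X Z + bstar Y Z ∧ bstar X (Y + Z) = bstar X Y + bstar X Z) ∧
    (∀ (c : ℂ) (X Y : Matrix (Fin n) (Fin n) ℂ), X.trace = 0 → Y.trace = 0 →
      bstar (c • X) Y = c • bstar X Y ∧ bstar X (c • Y) = c • bstar X Y) ∧
    (∀ X Y : Matrix (Fin n) (Fin n) ℂ, X.trace = 0 → Y.trace = 0 →
      bstar Y X = -bstar X Y) ∧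
    (∀ X Y Z : Matrix (Fin n) (Fin n) ℂ, X.trace = 0 → Y.trace = 0 → Z.trace = 0 →
      bstar (bstar X Y) Z + bstar (bstar Y Z) X + bstar (bstar Z X) Y = 0) ∧
    (∀ X Y : Matrix (Fin n) (Fin n) ℂ, X.trace = 0 → Y.trace = 0 →
      rplus (bstar X Y) = matComm (rplus X) (rplus Y) ∧
      rminus (bstar X Y) = matComm (rminus X) (rminus Y)) := by
  refine ⟨fun X Y Z _ _ _ => ⟨?_, ?_⟩, fun c X Y _ _ => ⟨?_, ?_⟩, fun X Y _ _ => ?_,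
    fun X Y Z _ _ _ => ?_, fun X Y _ _ => ⟨?_, ?_⟩⟩
  · simp only [bstar, matComm, rMat_add, add_mul, mul_add]
    module
  · simp only [bstar, matComm, rMat_add, add_mul, mul_add]
    module
  · simp only [bstar, matComm, rMat_smul, smul_mul_assoc, mul_smul_comm]
    module
  · simp only [bstar, matComm, rMat_smul, smul_mul_assoc, mul_smul_comm]
    module
  · simp only [bstar, matComm]
    module
  · simp only [bstar_bstar, matComm, add_mul, mul_add, sub_mul, mul_sub, mul_assoc]
    module
  · rw [rplus, rMat_bstar]
    simp only [bstar, rplus, matComm, smul_mul_assoc, mul_smul_comm, add_mul, mul_add]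
    module
  · rw [rminus, rMat_bstar]
    simp only [bstar, rminus, matComm, smul_mul_assoc, mul_smul_comm, sub_mul, mul_sub]
    module
end

section
/- Let g = sl_n(ℂ) (n ≥ 2), r(X) = X₋ − X₊, [X,Y]_* = ½([rX,Y] + [X,rY]), and r_± = ½(r ± id). Then the map X ↦ (r₊X, r₋X) from (g, [·,·]_*) to the direct sum Lie algebra g ⊕ g (with componentwise commutator bracket) is an injective Lie algebra homomorphism, and its image is exactly the set {(A, B) ∈ g ⊕ g : A is lower triangular, B is upper triangular, and diag(A) + diag(B) = 0}. -/
open Matrix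

open Matrix

theorem rplus_sub_rminus {n : ℕ} (X : Matrix (Fin n) (Fin n) ℂ) : rplus X - rminus X = X := by
  ext i j
  simp only [rplus, rminus, Matrix.sub_apply, Matrix.smul_apply, Matrix.add_apply, smul_eq_mul]
  ring

theorem rplus_add_rminus {n : ℕ} (X : Matrix (Fin n) (Fin n) ℂ) :
    rplus X + rminus X = rMat X := by
  ext i j
  simp only [rplus, rminus, Matrix.sub_apply, Matrix.smul_apply, Matrix.add_apply, smul_eq_mul]
  ring

theorem rplus_apply_self {n : ℕ} (X : Matrix (Fin n) (Fin n) ℂ) (i : Fin n) :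
    rplus X i i = (1 / 2 : ℂ) * X i i := by
  simp [rplus, rMat, strictLower, strictUpper]

theorem rminus_apply_self {n : ℕ} (X : Matrix (Fin n) (Fin n) ℂ) (i : Fin n) :
    rminus X i i = -(1 / 2 : ℂ) * X i i := by
  simp [rminus, rMat, strictLower, strictUpper]

theorem trace_rplus {n : ℕ} (X : Matrix (Fin n) (Fin n) ℂ) :
    (rplus X).trace = (1 / 2 : ℂ) * X.trace := by
  simp only [Matrix.trace, Matrix.diag_apply, rplus_apply_self, Finset.mul_sum]

theorem trace_rminus {n : ℕ} (X : Matrix (Fin n) (Fin n) ℂ) :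
    (rminus X).trace = -(1 / 2 : ℂ) * X.trace := by
  simp only [Matrix.trace, Matrix.diag_apply, rminus_apply_self, Finset.mul_sum]

theorem rplus_apply_of_lt {n : ℕ} (X : Matrix (Fin n) (Fin n) ℂ) {i j : Fin n} (h : i < j) :
    rplus X i j = 0 := by
  simp [rplus, rMat, strictLower, strictUpper, h, h.not_gt]

theorem rminus_apply_of_gt {n : ℕ} (X : Matrix (Fin n) (Fin n) ℂ) {i j : Fin n} (h : j < i) :
    rminus X i j = 0 := by
  simp [rminus, rMat, strictLower, strictUpper, h, h.not_gt]

theorem rplus_sub_of_triangular {n : ℕ} {A B : Matrix (Fin n) (Fin n) ℂ}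
    (hA : ∀ i j, i < j → A i j = 0) (hB : ∀ i j, j < i → B i j = 0)
    (hAB : ∀ i, A i i + B i i = 0) : rplus (A - B) = A := by
  ext i j
  rcases lt_trichotomy i j with h | rfl | h
  · rw [rplus_apply_of_lt _ h, hA i j h]
  · rw [rplus_apply_self, Matrix.sub_apply]
    linear_combination -(1 / 2 : ℂ) * hAB i
  · simp only [rplus, rMat, strictLower, strictUpper, Matrix.sub_apply, Matrix.smul_apply,
      Matrix.add_apply, smul_eq_mul, h, h.not_gt, if_true, if_false, hB i j h]
    ring

theorem rminus_sub_of_triangular {n : ℕ} {A B : Matrix (Fin n) (Fin n) ℂ}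
    (hA : ∀ i j, i < j → A i j = 0) (hB : ∀ i j, j < i → B i j = 0)
    (hAB : ∀ i, A i i + B i i = 0) : rminus (A - B) = B := by
  have h := rplus_sub_rminus (A - B)
  rw [rplus_sub_of_triangular hA hB hAB] at h
  exact sub_right_injective h

theorem bstar_eq {n : ℕ} (X Y : Matrix (Fin n) (Fin n) ℂ) :
    bstar X Y = matComm (rplus X) (rplus Y) - matComm (rminus X) (rminus Y) := by
  have key : matComm (rMat X) Y + matComm X (rMat Y) =
      (2 : ℂ) • (matComm (rplus X) (rplus Y) - matComm (rminus X) (rminus Y)) := by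
    conv_lhs => rw [← rplus_add_rminus X, ← rplus_add_rminus Y]
    conv_lhs =>
      enter [1, 2]
      rw [← rplus_sub_rminus Y]
    conv_lhs =>
      enter [2, 1]
      rw [← rplus_sub_rminus X]
    rw [two_smul]
    simp only [matComm]
    noncomm_ring
  rw [bstar, key, smul_smul]
  norm_num

theorem matComm_apply_eq_zero_of_le {n : ℕ} {A B : Matrix (Fin n) (Fin n) ℂ}
    (hA : ∀ i j, i < j → A i j = 0) (hB : ∀ i j, i < j → B i j = 0) {i j : Fin n} (h : i ≤ j) :
    matComm A B i j = 0 := by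
  rw [matComm, Matrix.sub_apply, Matrix.mul_apply, Matrix.mul_apply, ← Finset.sum_sub_distrib]
  refine Finset.sum_eq_zero fun k _ => ?_
  rcases lt_trichotomy i k with hk | rfl | hk
  · simp [hA i k hk, hB i k hk]
  · rcases h.eq_or_lt with rfl | h
    · ring
    · simp [hA i j h, hB i j h]
  · simp [hA k j (hk.trans_le h), hB k j (hk.trans_le h)]

theorem matComm_apply_eq_zero_of_ge {n : ℕ} {A B : Matrix (Fin n) (Fin n) ℂ}
    (hA : ∀ i j, j < i → A i j = 0) (hB : ∀ i j, j < i → B i j = 0) {i j : Fin n} (h : j ≤ i) :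
    matComm A B i j = 0 := by
  have key : matComm A B i j = matComm Bᵀ Aᵀ j i := by
    simp [matComm, ← Matrix.transpose_mul]
  rw [key]
  exact matComm_apply_eq_zero_of_le (fun i j hij => hB j i hij) (fun i j hij => hA j i hij) h

/-- The map `X ↦ (r₊X, r₋X)` is an injective Lie algebra homomorphism
from `(sl_n(ℂ), [·,·]_*)` to `sl_n(ℂ) ⊕ sl_n(ℂ)` (componentwise commutator), whose image is
the set of pairs `(A, B)` of traceless matrices with `A` lower triangular, `B` upper
triangular and `diag A + diag B = 0`. -/
theorem stmt_4 (n : ℕ) (hn : 2 ≤ n) :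
    (∀ X Y : Matrix (Fin n) (Fin n) ℂ, X.trace = 0 → Y.trace = 0 →
      rplus X = rplus Y → rminus X = rminus Y → X = Y) ∧
    (∀ X Y : Matrix (Fin n) (Fin n) ℂ, X.trace = 0 → Y.trace = 0 →
      rplus (bstar X Y) = matComm (rplus X) (rplus Y) ∧
      rminus (bstar X Y) = matComm (rminus X) (rminus Y)) ∧
    (∀ A B : Matrix (Fin n) (Fin n) ℂ,
      (∃ X : Matrix (Fin n) (Fin n) ℂ, X.trace = 0 ∧ rplus X = A ∧ rminus X = B) ↔
      (A.trace = 0 ∧ B.trace = 0 ∧ (∀ i j, i < j → A i j = 0) ∧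
        (∀ i j, j < i → B i j = 0) ∧ ∀ i, A i i + B i i = 0)) := by
  refine ⟨fun X Y _ _ hp hm => ?_, fun X Y _ _ => ?_, fun A B => ⟨?_, ?_⟩⟩
  · rw [← rplus_sub_rminus X, hp, hm, rplus_sub_rminus]
  · have hP {i j : Fin n} (h : i ≤ j) : matComm (rplus X) (rplus Y) i j = 0 :=
      matComm_apply_eq_zero_of_le (fun _ _ => rplus_apply_of_lt X) (fun _ _ => rplus_apply_of_lt Y) h
    have hM {i j : Fin n} (h : j ≤ i) : matComm (rminus X) (rminus Y) i j = 0 :=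
      matComm_apply_eq_zero_of_ge (fun _ _ => rminus_apply_of_gt X)
        (fun _ _ => rminus_apply_of_gt Y) h
    have hd (i : Fin n) :
        matComm (rplus X) (rplus Y) i i + matComm (rminus X) (rminus Y) i i = 0 := by
      rw [hP le_rfl, hM le_rfl, add_zero]
    rw [bstar_eq]
    exact ⟨rplus_sub_of_triangular (fun _ _ h => hP h.le) (fun _ _ h => hM h.le) hd,
      rminus_sub_of_triangular (fun _ _ h => hP h.le) (fun _ _ h => hM h.le) hd⟩
  · rintro ⟨X, hX, rfl, rfl⟩
    refine ⟨by rw [trace_rplus, hX, mul_zero], by rw [trace_rminus, hX, mul_zero],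
      fun _ _ => rplus_apply_of_lt X, fun _ _ => rminus_apply_of_gt X, fun i => ?_⟩
    rw [rplus_apply_self, rminus_apply_self]
    ring
  · rintro ⟨hA, hB, hAl, hBu, hd⟩
    exact ⟨A - B, by rw [Matrix.trace_sub, hA, hB, sub_zero],
      rplus_sub_of_triangular hAl hBu hd, rminus_sub_of_triangular hAl hBu hd⟩
end

section
/- Work in SL(3,ℂ). Let N be the subgroup of lower-triangular unipotent matrices, s the matrix [[0,0,1],[0,−1,0],[1,0,0]] (so s⁻¹ = s), Z = {diag(t, t⁻², t) : t ∈ ℂ*}, and for t ∈ ℂ*, α, β, γ ∈ ℂ let S(t,α,β,γ) = [[0,0,t],[0,−t⁻²,α],[t,β,γ]]. Let NZs⁻¹N = {n₁ z s⁻¹ n₂ : n₁, n₂ ∈ N, z ∈ Z}. Then every matrix S(t,α,β,γ) lies in NZs⁻¹N, and the conjugation map (n, (t,α,β,γ)) ↦ n · S(t,α,β,γ) · n⁻¹ is a bijection from N × (ℂ* × ℂ³) onto NZs⁻¹N. -/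
open Matrix

/-- The element of the transversal slice `N_s Z s⁻¹ ⊂ SL(3,ℂ)` with parameters
`t ∈ ℂ*`, `α, β, γ ∈ ℂ`. -/
noncomputable def Smat (t α β γ : ℂ) : Matrix (Fin 3) (Fin 3) ℂ :=
  !![0, 0, t; 0, -(t ^ 2)⁻¹, α; t, β, γ]

/-- The normal representative `s` of the Weyl group element (note `s⁻¹ = s`). -/
noncomputable def sMat : Matrix (Fin 3) (Fin 3) ℂ :=
  !![0, 0, 1; 0, -1, 0; 1, 0, 0]

/-- Membership in `N`, the subgroup of lower-triangular unipotent matrices. -/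
def IsN (m : Matrix (Fin 3) (Fin 3) ℂ) : Prop :=
  m 0 0 = 1 ∧ m 1 1 = 1 ∧ m 2 2 = 1 ∧ m 0 1 = 0 ∧ m 0 2 = 0 ∧ m 1 2 = 0

/-- Membership in `Z = {diag(t, t⁻², t) : t ∈ ℂ*}`. -/
def IsZ (m : Matrix (Fin 3) (Fin 3) ℂ) : Prop :=
  ∃ t : ℂ, t ≠ 0 ∧ m = Matrix.diagonal ![t, (t ^ 2)⁻¹, t]

/-- Membership in the variety `N Z s⁻¹ N`. -/
def InNZsN (g : Matrix (Fin 3) (Fin 3) ℂ) : Prop :=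
  ∃ n₁ z n₂ : Matrix (Fin 3) (Fin 3) ℂ,
    IsN n₁ ∧ IsZ z ∧ IsN n₂ ∧ g = n₁ * z * sMat * n₂

namespace IsN

variable {m m' : Matrix (Fin 3) (Fin 3) ℂ}

lemma eq_of (h : IsN m) : m = !![1, 0, 0; m 1 0, 1, 0; m 2 0, m 2 1, 1] := by
  obtain ⟨h00, h11, h22, h01, h02, h12⟩ := h
  ext i j
  fin_cases i <;> fin_cases j <;> simp [*]

lemma mul (h : IsN m) (h' : IsN m') : IsN (m * m') := by
  rw [h.eq_of, h'.eq_of]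
  simp [IsN, Matrix.mul_apply, Fin.sum_univ_three]

lemma det_eq_one (h : IsN m) : m.det = 1 := by
  rw [h.eq_of]
  simp [Matrix.det_fin_three]

lemma isUnit_det (h : IsN m) : IsUnit m.det := by
  simp [h.det_eq_one]

lemma inv (h : IsN m) : IsN m⁻¹ := by
  rw [Matrix.inv_def, h.det_eq_one, h.eq_of]
  simp [IsN, Matrix.adjugate_fin_three]

end IsN

/-- The slice is `N Z s⁻¹`: right multiplication of a unipotent matrix by `z s⁻¹`. -/
lemma IsN.mul_diagonal_mul_sMat {m : Matrix (Fin 3) (Fin 3) ℂ} (h : IsN m) {t : ℂ} :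
    m * Matrix.diagonal ![t, (t ^ 2)⁻¹, t] * sMat =
      Smat t (m 1 0 * t) (-(m 2 1 * (t ^ 2)⁻¹)) (m 2 0 * t) := by
  rw [h.eq_of]
  ext i j
  fin_cases i <;> fin_cases j <;>
    simp [Smat, sMat, Matrix.mul_apply, Matrix.vecMul_diagonal, Fin.sum_univ_three]

lemma Smat.exists_eq_mul {t : ℂ} (α β γ : ℂ) (ht : t ≠ 0) :
    ∃ m, IsN m ∧ Smat t α β γ = m * Matrix.diagonal ![t, (t ^ 2)⁻¹, t] * sMat := by
  have hm : IsN !![1, 0, 0; α / t, 1, 0; γ / t, -β * t ^ 2, 1] := by simp [IsN]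
  refine ⟨_, hm, ?_⟩
  rw [hm.mul_diagonal_mul_sMat]
  simp [ht]

/-- Conjugation by `N` is free on the slice and separates its points. -/
lemma IsN.eq_one_of_mul_Smat_eq {m : Matrix (Fin 3) (Fin 3) ℂ} (h : IsN m)
    {t t' α α' β β' γ γ' : ℂ} (ht' : t' ≠ 0)
    (hS : m * Smat t α β γ = Smat t' α' β' γ' * m) : m = 1 := by
  have entry (i j : Fin 3) := congrFun (congrFun hS i) j
  obtain ⟨h00, h11, h22, h01, h02, h12⟩ := id h
  have h20 : m 2 0 = 0 := by
    simpa [Smat, Matrix.mul_apply, Fin.sum_univ_three, ht', *] using (entry 0 0).symm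
  have h21 : m 2 1 = 0 := by
    simpa [Smat, Matrix.mul_apply, Fin.sum_univ_three, ht', *] using (entry 0 1).symm
  have h10 : m 1 0 = 0 := by
    simpa [Smat, Matrix.mul_apply, Fin.sum_univ_three, ht', *] using (entry 1 0).symm
  rw [h.eq_of, h10, h20, h21, Matrix.one_fin_three]

lemma Smat.inj {t t' α α' β β' γ γ' : ℂ} (h : Smat t α β γ = Smat t' α' β' γ') :
    t = t' ∧ α = α' ∧ β = β' ∧ γ = γ' := by
  have entry (i j : Fin 3) := congrFun (congrFun h i) j
  exact ⟨by simpa [Smat] using entry 0 2, by simpa [Smat] using entry 1 2,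
    by simpa [Smat] using entry 2 1, by simpa [Smat] using entry 2 2⟩

/-- Every slice element `S(t,α,β,γ)` lies in `N Z s⁻¹ N`, and the
conjugation map `(n, (t,α,β,γ)) ↦ n · S(t,α,β,γ) · n⁻¹` is a bijection from
`N × (ℂ* × ℂ³)` onto `N Z s⁻¹ N` (the cross-section theorem for `SL(3,ℂ)`). -/
theorem stmt_6 :
    (∀ t α β γ : ℂ, t ≠ 0 → InNZsN (Smat t α β γ)) ∧
    (∀ (nm : Matrix (Fin 3) (Fin 3) ℂ) (t α β γ : ℂ), IsN nm → t ≠ 0 →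
      InNZsN (nm * Smat t α β γ * nm⁻¹)) ∧
    (∀ (nm nm' : Matrix (Fin 3) (Fin 3) ℂ) (t t' α α' β β' γ γ' : ℂ),
      IsN nm → IsN nm' → t ≠ 0 → t' ≠ 0 →
      nm * Smat t α β γ * nm⁻¹ = nm' * Smat t' α' β' γ' * nm'⁻¹ →
      nm = nm' ∧ t = t' ∧ α = α' ∧ β = β' ∧ γ = γ') ∧
    (∀ g : Matrix (Fin 3) (Fin 3) ℂ, InNZsN g →
      ∃ (nm : Matrix (Fin 3) (Fin 3) ℂ) (t α β γ : ℂ),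
        IsN nm ∧ t ≠ 0 ∧ g = nm * Smat t α β γ * nm⁻¹) := by
  have conj_mem (nm : Matrix (Fin 3) (Fin 3) ℂ) (t α β γ : ℂ) (hn : IsN nm) (ht : t ≠ 0) :
      InNZsN (nm * Smat t α β γ * nm⁻¹) := by
    obtain ⟨m, hm, hS⟩ := Smat.exists_eq_mul α β γ ht
    exact ⟨nm * m, _, nm⁻¹, hn.mul hm, ⟨t, ht, rfl⟩, hn.inv, by simp only [hS, Matrix.mul_assoc]⟩
  refine ⟨fun t α β γ ht => ?_, conj_mem, ?_, ?_⟩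
  · simpa using conj_mem 1 t α β γ (by simp [IsN]) ht
  · intro nm nm' t t' α α' β β' γ γ' hn hn' _ ht' h
    have hm : nm'⁻¹ * nm * Smat t α β γ = Smat t' α' β' γ' * (nm'⁻¹ * nm) := by
      calc nm'⁻¹ * nm * Smat t α β γ
          = nm'⁻¹ * (nm * Smat t α β γ * nm⁻¹) * nm := by
            simp only [Matrix.mul_assoc, Matrix.nonsing_inv_mul nm hn.isUnit_det, Matrix.mul_one]
        _ = Smat t' α' β' γ' * (nm'⁻¹ * nm) := by
            rw [h]
            simp only [Matrix.mul_assoc,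
              Matrix.nonsing_inv_mul_cancel_left _ _ hn'.isUnit_det]
    have h1 : nm'⁻¹ * nm = 1 := (hn'.inv.mul hn).eq_one_of_mul_Smat_eq ht' hm
    rw [h1, Matrix.one_mul, Matrix.mul_one] at hm
    refine ⟨?_, Smat.inj hm⟩
    rw [← Matrix.mul_nonsing_inv_cancel_left nm' nm hn'.isUnit_det, h1, Matrix.mul_one]
  · rintro g ⟨n₁, z, n₂, h₁, ⟨t, ht, rfl⟩, h₂, rfl⟩
    refine ⟨n₂⁻¹, t, (n₂ * n₁) 1 0 * t, -((n₂ * n₁) 2 1 * (t ^ 2)⁻¹), (n₂ * n₁) 2 0 * t,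
      h₂.inv, ht, ?_⟩
    rw [← (h₂.mul h₁).mul_diagonal_mul_sMat, Matrix.nonsing_inv_nonsing_inv _ h₂.isUnit_det]
    simp only [Matrix.mul_assoc, Matrix.nonsing_inv_mul_cancel_left _ _ h₂.isUnit_det]
end

section
/- Work in SL(3,ℂ). Let N be the subgroup of lower-triangular unipotent matrices, s = [[0,0,1],[0,−1,0],[1,0,0]], Z = {diag(t,t⁻²,t) : t ∈ ℂ*}, NZs⁻¹N = {n₁ z s⁻¹ n₂ : n₁,n₂ ∈ N, z ∈ Z}, and S(t,α,β,γ) = [[0,0,t],[0,−t⁻²,α],[t,β,γ]] for t ∈ ℂ*, α,β,γ ∈ ℂ. For a matrix g = (g_{ij}) with g₁₃ ≠ 0 define φ̄_α(g) = g₁₃²(g₁₁g₂₃ − g₁₃g₂₁) + g₂₃, φ̄_β(g) = g₃₂ − g₁₂g₁₃⁻³(1 + g₁₃²g₃₃), φ̄_γ(g) = g₁₁ + g₂₂ + g₃₃ + g₁₃⁻², φ̄_t(g) = g₁₃. Then: (1) every g ∈ NZs⁻¹N has g₁₃ ≠ 0; (2) for every n ∈ N and g ∈ NZs⁻¹N,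 each of the four functions satisfies φ̄(n g n⁻¹) = φ̄(g); and (3) φ̄_α(S(t,α,β,γ)) = α, φ̄_β(S(t,α,β,γ)) = β, φ̄_γ(S(t,α,β,γ)) = γ, φ̄_t(S(t,α,β,γ)) = t. -/
open Matrix

/-- `φ̄_α(g) = g₁₃²(g₁₁g₂₃ − g₁₃g₂₁) + g₂₃`. -/
noncomputable def phiA (g : Matrix (Fin 3) (Fin 3) ℂ) : ℂ :=
  (g 0 2) ^ 2 * (g 0 0 * g 1 2 - g 0 2 * g 1 0) + g 1 2

/-- `φ̄_β(g) = g₃₂ − g₁₂ g₁₃⁻³ (1 + g₁₃² g₃₃)`. -/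
noncomputable def phiB (g : Matrix (Fin 3) (Fin 3) ℂ) : ℂ :=
  g 2 1 - g 0 1 * ((g 0 2) ^ 3)⁻¹ * (1 + (g 0 2) ^ 2 * g 2 2)

/-- `φ̄_γ(g) = g₁₁ + g₂₂ + g₃₃ + g₁₃⁻²`. -/
noncomputable def phiG (g : Matrix (Fin 3) (Fin 3) ℂ) : ℂ :=
  g 0 0 + g 1 1 + g 2 2 + ((g 0 2) ^ 2)⁻¹

/-- `φ̄_t(g) = g₁₃`. -/
noncomputable def phiT (g : Matrix (Fin 3) (Fin 3) ℂ) : ℂ :=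
  g 0 2

/-- The lower-triangular unipotent matrix with the given subdiagonal entries. -/
def lowerUnipotent (a b c : ℂ) : Matrix (Fin 3) (Fin 3) ℂ :=
  !![1, 0, 0; a, 1, 0; c, b, 1]

lemma IsN.eq_lowerUnipotent {m : Matrix (Fin 3) (Fin 3) ℂ} (h : IsN m) :
    m = lowerUnipotent (m 1 0) (m 2 1) (m 2 0) := by
  obtain ⟨h1, h2, h3, h4, h5, h6⟩ := h
  ext i j
  fin_cases i <;> fin_cases j <;> simp [lowerUnipotent, *]

lemma lowerUnipotent_inv (a b c : ℂ) :
    (lowerUnipotent a b c)⁻¹ = lowerUnipotent (-a) (-b) (a * b - c) := by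
  apply Matrix.inv_eq_right_inv
  ext i j
  fin_cases i <;> fin_cases j <;>
    simp [lowerUnipotent, Matrix.mul_apply, Fin.sum_univ_three]
  ring

/-- On `N Z s⁻¹ N` the upper right corner entry is nonzero, and it is inverse to the upper right
`2 × 2` minor. -/
lemma InNZsN.minors {g : Matrix (Fin 3) (Fin 3) ℂ} (h : InNZsN g) :
    g 0 2 ≠ 0 ∧ g 0 2 * (g 0 1 * g 1 2 - g 0 2 * g 1 1) = 1 := by
  obtain ⟨n₁, z, n₂, h₁, ⟨t, ht, rfl⟩, h₂, rfl⟩ := h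
  rw [h₁.eq_lowerUnipotent, h₂.eq_lowerUnipotent]
  simp only [lowerUnipotent, sMat, Matrix.mul_apply, Fin.sum_univ_three, Matrix.diagonal_apply]
  simp [ht]
  field_simp
  ring

/-- Entries of the conjugate of `g` by a lower-triangular unipotent matrix. -/
lemma conj_lowerUnipotent (a b c : ℂ) (g : Matrix (Fin 3) (Fin 3) ℂ) (i j : Fin 3) :
    (lowerUnipotent a b c * g * (lowerUnipotent a b c)⁻¹) i j =
      ∑ k, (∑ l, lowerUnipotent a b c i l * g l k) *
        lowerUnipotent (-a) (-b) (a * b - c) k j := by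
  simp [lowerUnipotent_inv, Matrix.mul_apply]

/-- (1) Every `g ∈ N Z s⁻¹ N` has `g₁₃ ≠ 0`; (2) the four functions
`φ̄_α, φ̄_β, φ̄_γ, φ̄_t` are invariant under conjugation by `N` on `N Z s⁻¹ N`; and
(3) they restrict to the coordinates `α, β, γ, t` on the slice. -/
theorem stmt_8 :
    (∀ g : Matrix (Fin 3) (Fin 3) ℂ, InNZsN g → g 0 2 ≠ 0) ∧
    (∀ (nm g : Matrix (Fin 3) (Fin 3) ℂ), IsN nm → InNZsN g →
      phiA (nm * g * nm⁻¹) = phiA g ∧ phiB (nm * g * nm⁻¹) = phiB g ∧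
      phiG (nm * g * nm⁻¹) = phiG g ∧ phiT (nm * g * nm⁻¹) = phiT g) ∧
    (∀ t α β γ : ℂ, t ≠ 0 →
      phiA (Smat t α β γ) = α ∧ phiB (Smat t α β γ) = β ∧
      phiG (Smat t α β γ) = γ ∧ phiT (Smat t α β γ) = t) := by
  refine ⟨fun g hg => hg.minors.1, fun nm g hn hg => ?_, fun t α β γ ht => ?_⟩
  · obtain ⟨ht, hm⟩ := hg.minors
    rw [hn.eq_lowerUnipotent]
    generalize nm 1 0 = a, nm 2 1 = b, nm 2 0 = c
    simp only [phiA, phiB, phiG, phiT, conj_lowerUnipotent, Fin.sum_univ_three]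
    simp [lowerUnipotent]
    refine ⟨?_, ?_, ?_⟩
    · linear_combination (-a * g 0 2) * hm
    · field_simp
      linear_combination (-b * g 0 2) * hm
    · ring
  · simp [phiA, phiB, phiG, phiT, Smat]
end

section
/- Let t ∈ ℂ* and α, β, γ ∈ ℂ, and let S = S(t,α,β,γ) = [[0,0,t],[0,−t⁻²,α],[t,β,γ]]. Set x = t²α, y = t²β, z = t² + 1 (so z ≠ 1). Then tr S = 3 and tr(S²) = 3 hold simultaneously if and only if γ = 1/(z−1) + 3 and z³ + x y = 0. In particular, the fiber of the conjugation quotient map over the unipotent class, intersected with the slice {S(t,α,β,γ)}, is isomorphic to the surface {(x,y,z) ∈ ℂ³ : z³ + xy = 0, z ≠ 1}, which has a simple singularity of type A₂ at the origin. -/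
open Matrix

theorem trace_Smat (t α β γ : ℂ) : (Smat t α β γ).trace = γ - (t ^ 2)⁻¹ := by
  simp [Smat, Matrix.trace_fin_three]
  ring

theorem trace_Smat_mul_self (t α β γ : ℂ) :
    (Smat t α β γ * Smat t α β γ).trace =
      ((t ^ 2)⁻¹) ^ 2 + γ ^ 2 + 2 * t ^ 2 + 2 * (α * β) := by
  simp [Smat, Matrix.trace_fin_three]
  ring

/-- The two trace equations cut out the singular fiber inside the slice. -/
theorem trace_Smat_eq_three_iff {t : ℂ} (ht : t ≠ 0) (α β γ : ℂ) :
    ((Smat t α β γ).trace = 3 ∧ (Smat t α β γ * Smat t α β γ).trace = 3) ↔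
      (γ = 1 / (t ^ 2 + 1 - 1) + 3 ∧
        (t ^ 2 + 1) ^ 3 + (t ^ 2 * α) * (t ^ 2 * β) = 0) := by
  have hu : t ^ 2 * (t ^ 2)⁻¹ = 1 := mul_inv_cancel₀ (pow_ne_zero 2 ht)
  rw [trace_Smat, trace_Smat_mul_self, add_sub_cancel_right, one_div]
  generalize (t ^ 2)⁻¹ = u at *
  generalize t ^ 2 = w at *
  rw [sub_eq_iff_eq_add, add_comm 3 u]
  refine and_congr_right fun hγ => ?_
  subst hγ
  constructor
  · intro h
    linear_combination w ^ 2 / 2 * h - (w * u + 1 + 3 * w) * hu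
  · intro h
    have hw : w ^ 2 ≠ 0 := pow_ne_zero 2 (left_ne_zero_of_mul_eq_one hu)
    refine mul_left_cancel₀ hw ?_
    linear_combination 2 * h + 2 * (w * u + 1 + 3 * w) * hu

/-- On the slice, with `x = t²α`, `y = t²β`, `z = t² + 1` (so `z ≠ 1`),
the equations `tr S = 3` and `tr S² = 3` hold simultaneously iff `γ = 1/(z−1) + 3` and
`z³ + xy = 0`; moreover every point of the surface `{z³ + xy = 0, z ≠ 1}` (the `A₂`
singularity) arises this way from a point of the singular fiber. -/
theorem stmt_10 (t α β γ : ℂ) (ht : t ≠ 0) :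
    t ^ 2 + 1 ≠ 1 ∧
    (((Smat t α β γ).trace = 3 ∧ (Smat t α β γ * Smat t α β γ).trace = 3) ↔
      (γ = 1 / (t ^ 2 + 1 - 1) + 3 ∧
        (t ^ 2 + 1) ^ 3 + (t ^ 2 * α) * (t ^ 2 * β) = 0)) ∧
    (∀ x y z : ℂ, z ^ 3 + x * y = 0 → z ≠ 1 →
      ∃ t' α' β' γ' : ℂ, t' ≠ 0 ∧
        (Smat t' α' β' γ').trace = 3 ∧
        (Smat t' α' β' γ' * Smat t' α' β' γ').trace = 3 ∧
        x = t' ^ 2 * α' ∧ y = t' ^ 2 * β' ∧ z = t' ^ 2 + 1) := by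
  refine ⟨by simpa using ht, trace_Smat_eq_three_iff ht α β γ, fun x y z h hz => ?_⟩
  obtain ⟨s, hs⟩ := IsAlgClosed.exists_pow_nat_eq (z - 1) two_pos
  have hs0 : s ≠ 0 := by
    rintro rfl
    exact hz (by linear_combination -hs)
  have hx : x = s ^ 2 * (x / s ^ 2) := by field_simp
  have hy : y = s ^ 2 * (y / s ^ 2) := by field_simp
  have hzs : z = s ^ 2 + 1 := by linear_combination -hs
  obtain ⟨h₁, h₂⟩ := (trace_Smat_eq_three_iff hs0 (x / s ^ 2) (y / s ^ 2) _).2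
    ⟨rfl, by rw [← hx, ← hy, ← hzs, h]⟩
  exact ⟨s, _, _, _, hs0, h₁, h₂, hx, hy, hzs⟩
end

section
/- Let A = ℂ[x_{ij} : 1 ≤ i,j ≤ 3] be the polynomial ring in nine variables. Suppose {·,·} : A × A → A is ℂ-bilinear, is a derivation in each argument, and satisfies on generators {x_{ij}, x_{km}} = x_{im}x_{kj}(ε_{ik} + ε_{mj}) + 2δ_{im} Σ_{l>i} x_{kl}x_{lj} − 2δ_{jk} Σ_{l>j} x_{il}x_{lm} + x_{ij}x_{km}(δ_{im} − δ_{jk}), where ε_{ab} = 1 if a > b, 0 if a = b, −1 if a < b, and δ is the Kronecker delta. Then the elements T₁ = Σ_{i=1}^{3} x_{ii} and T₂ = Σ_{i,j=1}^{3} x_{ij}x_{ji} are Casimirs on generators: {T₁, x_{km}} = 0 and {T₂, x_{km}} = 0 for all 1 ≤ k, m ≤ 3. -/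
open MvPolynomial

/-- The polynomial ring `A = ℂ[x_{ij} : 1 ≤ i,j ≤ 3]`. -/
noncomputable abbrev PRing : Type := MvPolynomial (Fin 3 × Fin 3) ℂ

/-- The generator `x_{ij}`. -/
noncomputable def xv (i j : Fin 3) : PRing := X (i, j)

/-- `ε_{ab} = 1` if `a > b`, `0` if `a = b`, `−1` if `a < b`. -/
noncomputable def eps (a b : Fin 3) : ℂ := if b < a then 1 else if a = b then 0 else -1

/-- The Kronecker delta `δ_{ab}`. -/
noncomputable def kdelta (a b : Fin 3) : ℂ := if a = b then 1 else 0

/-- If `{·,·}` is a ℂ-bilinear bracket on `ℂ[x_{ij}]`, a derivation in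
each argument, given on generators by formula (4.7) of the paper, then
`T₁ = Σ x_{ii}` and `T₂ = Σ x_{ij}x_{ji}` satisfy `{T₁, x_{km}} = 0 = {T₂, x_{km}}`. -/
theorem stmt_11 (B : PRing → PRing → PRing)
    (hadd_l : ∀ a b c : PRing, B (a + b) c = B a c + B b c)
    (hadd_r : ∀ a b c : PRing, B a (b + c) = B a b + B a c)
    (hsmul_l : ∀ (r : ℂ) (a b : PRing), B (r • a) b = r • B a b)
    (hsmul_r : ∀ (r : ℂ) (a b : PRing), B a (r • b) = r • B a b)
    (hder_l : ∀ a b c : PRing, B (a * b) c = a * B b c + B a c * b)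
    (hder_r : ∀ a b c : PRing, B a (b * c) = B a b * c + b * B a c)
    (hgen : ∀ i j k m : Fin 3,
      B (xv i j) (xv k m) =
        C (eps i k + eps m j) * (xv i m * xv k j)
          + C (2 * kdelta i m) *
            (∑ l ∈ Finset.univ.filter (fun l => i < l), xv k l * xv l j)
          - C (2 * kdelta j k) *
            (∑ l ∈ Finset.univ.filter (fun l => j < l), xv i l * xv l m)
          + C (kdelta i m - kdelta j k) * (xv i j * xv k m)) :
    ∀ k m : Fin 3,
      B (∑ i, xv i i) (xv k m) = 0 ∧
      B (∑ i, ∑ j, xv i j * xv j i) (xv k m) = 0 := by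
  intro k m
  have gt0 : Finset.univ.filter (fun l : Fin 3 => 0 < l) = {1, 2} := by decide
  have gt1 : Finset.univ.filter (fun l : Fin 3 => 1 < l) = {2} := by decide
  have gt2 : Finset.univ.filter (fun l : Fin 3 => 2 < l) = ∅ := by decide
  have C_two : (C 2 : PRing) = 2 := map_ofNat C 2
  constructor
  · simp only [Fin.sum_univ_three, hadd_l, hgen]
    fin_cases k <;> fin_cases m <;> simp [eps, kdelta, gt0, gt1, gt2, C_two] <;> ring
  · simp only [Fin.sum_univ_three, hadd_l, hder_l, hgen]
    fin_cases k <;> fin_cases m <;> simp [eps, kdelta, gt0, gt1, gt2, C_two] <;> ring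
end

section
/- Let g be a finite-dimensional complex semisimple Lie algebra with Killing form κ, and let (e, h, f) be an sl₂-triple in g, i.e. nonzero elements satisfying [h,e] = 2e, [h,f] = −2f, [e,f] = h. Let g(−1) = {x ∈ g : [h,x] = −x} be the (−1)-eigenspace of ad h, and define the bilinear form ω on g(−1) by ω(x,y) = κ(e, [x,y]). Then ω is skew-symmetric and nondegenerate on g(−1). -/
namespace IsSl2Triple

open LieModule Module

variable {K L M : Type*} [Field K] [LieRing L] [LieAlgebra K L]
  [AddCommGroup M] [Module K M] [LieRingModule L M] [LieModule K L M] {h e f : L}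

lemma lie_h_lie_e (t : IsSl2Triple h e f) (m : M) :
    ⁅h, ⁅e, m⁆⁆ = ⁅e, ⁅h, m⁆⁆ + (2 : K) • ⁅e, m⁆ := by
  rw [leibniz_lie, t.lie_h_e_smul K, smul_lie, add_comm]

lemma lie_h_lie_f (t : IsSl2Triple h e f) (m : M) :
    ⁅h, ⁅f, m⁆⁆ = ⁅f, ⁅h, m⁆⁆ - (2 : K) • ⁅f, m⁆ := by
  rw [leibniz_lie, t.lie_lie_smul_f K, neg_lie, smul_lie]
  module

lemma lie_e_lie_f (t : IsSl2Triple h e f) (m : M) :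
    ⁅e, ⁅f, m⁆⁆ = ⁅f, ⁅e, m⁆⁆ + ⁅h, m⁆ := by
  rw [leibniz_lie, t.lie_e_f, add_comm]

lemma lie_h_pow_e (t : IsSl2Triple h e f) (k : ℕ) (m : M) :
    ⁅h, (toEnd K L M e ^ k) m⁆ =
      (toEnd K L M e ^ k) ⁅h, m⁆ + (2 * k : K) • (toEnd K L M e ^ k) m := by
  induction k with
  | zero => simp
  | succ k ih =>
    simp only [pow_succ', Module.End.mul_apply, toEnd_apply_apply]
    rw [t.lie_h_lie_e (K := K), ih, lie_add, lie_smul]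
    push_cast
    module

lemma lie_h_pow_f (t : IsSl2Triple h e f) (k : ℕ) (m : M) :
    ⁅h, (toEnd K L M f ^ k) m⁆ =
      (toEnd K L M f ^ k) ⁅h, m⁆ - (2 * k : K) • (toEnd K L M f ^ k) m := by
  have := t.symm.lie_h_pow_e (K := K) k m
  simp only [neg_lie, map_neg] at this
  rw [neg_eq_iff_eq_neg] at this
  rw [this]
  module

lemma pow_succ_e_lie_f (t : IsSl2Triple h e f) (k : ℕ) (m : M) :
    (toEnd K L M e ^ (k + 1)) ⁅f, m⁆ = ⁅f, (toEnd K L M e ^ (k + 1)) m⁆ +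
      (k + 1 : K) • (toEnd K L M e ^ k) (⁅h, m⁆ + (k : K) • m) := by
  induction k with
  | zero => simp [t.lie_e_lie_f]
  | succ k ih =>
    rw [pow_succ' _ (k + 1), Module.End.mul_apply, ih, Module.End.mul_apply, toEnd_apply_apply,
      toEnd_apply_apply, lie_add, lie_smul, t.lie_e_lie_f, t.lie_h_pow_e, ← toEnd_apply_apply K,
      ← toEnd_apply_apply K L M e ((toEnd K L M e ^ k) _), ← Module.End.mul_apply, ← pow_succ']
    simp only [map_add, map_smul]
    push_cast
    module

lemma lie_e_pow_succ_f (t : IsSl2Triple h e f) {m : M} (hm : ⁅e, m⁆ = 0) (k : ℕ) :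
    ⁅e, (toEnd K L M f ^ (k + 1)) m⁆ =
      (k + 1 : K) • (toEnd K L M f ^ k) (⁅h, m⁆ - (k : K) • m) := by
  have := t.symm.pow_succ_e_lie_f (K := K) k m
  rw [hm, map_zero, neg_lie, add_comm, eq_comm, ← sub_eq_zero, sub_zero, add_comm,
    add_eq_zero_iff_eq_neg] at this
  rw [this, ← smul_neg, ← map_neg]
  congr 2
  module

/-- A string of vectors `fᵏ m`, each recovered from the next by applying `e` up to a nonzero
scalar, vanishes altogether as soon as its last member does. -/
lemma pow_f_eq_zero_of_forall_lie_e {m : M} {c : ℕ → K} {n N : ℕ} (hnN : n ≤ N)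
    (hc : ∀ k, n ≤ k → k < N → c k ≠ 0)
    (hm : ∀ k, n ≤ k → k < N →
      ⁅e, (toEnd K L M f ^ (k + 1)) m⁆ = c k • (toEnd K L M f ^ k) m)
    (hN : (toEnd K L M f ^ N) m = 0) :
    (toEnd K L M f ^ n) m = 0 := by
  induction N, hnN using Nat.le_induction with
  | base => exact hN
  | succ N hnN ih =>
    refine ih (fun k hk hkN ↦ hc k hk (by omega)) (fun k hk hkN ↦ hm k hk (by omega)) ?_
    have := hm N hnN N.lt_succ_self
    rw [hN, lie_zero, eq_comm, smul_eq_zero] at this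
    exact this.resolve_left (hc N hnN N.lt_succ_self)

variable [CharZero K]

lemma pow_f_eq_zero_of_lie_e_eq_zero (t : IsSl2Triple h e f) {m : M} {μ : K} {n N : ℕ}
    (hnN : n ≤ N) (hμ : ∀ k : ℕ, n ≤ k → k < N → μ ≠ k) (he : ⁅e, m⁆ = 0) (hh : ⁅h, m⁆ = μ • m)
    (hN : (toEnd K L M f ^ N) m = 0) :
    (toEnd K L M f ^ n) m = 0 := by
  refine pow_f_eq_zero_of_forall_lie_e (e := e) (c := fun k ↦ (k + 1 : K) * (μ - k)) hnN
    (fun k hk hkN ↦ mul_ne_zero (Nat.cast_add_one_ne_zero k) (sub_ne_zero.mpr (hμ k hk hkN)))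
    (fun k _ _ ↦ ?_) hN
  rw [t.lie_e_pow_succ_f he, hh, ← sub_smul, map_smul, smul_smul]

/-- An eigenvector of `h` with positive integral eigenvalue lies in the image of `e`. -/
lemma exists_lie_e_eq (t : IsSl2Triple h e f) {ν : ℕ} (hν : ν ≠ 0) (k : ℕ) {a : M}
    (ha : ⁅h, a⁆ = (ν : K) • a) (hk : (toEnd K L M e ^ k) a = 0) :
    ∃ b : M, ⁅e, b⁆ = a ∧ ⁅h, b⁆ = (ν - 2 : K) • b := by
  induction k generalizing a with
  | zero => exact ⟨0, by simpa [eq_comm] using hk⟩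
  | succ k ih =>
    have hea : ⁅h, ⁅e, a⁆⁆ = (ν + 2 : K) • ⁅e, a⁆ := by
      rw [t.lie_h_lie_e (K := K), ha, lie_smul]
      module
    have hfa : ⁅h, ⁅f, a⁆⁆ = (ν - 2 : K) • ⁅f, a⁆ := by
      rw [t.lie_h_lie_f (K := K), ha, lie_smul]
      module
    have hk' : (toEnd K L M e ^ k) ⁅e, a⁆ = 0 := by
      rwa [← toEnd_apply_apply K, ← Module.End.mul_apply, ← pow_succ]
    obtain ⟨b, hb, hb'⟩ := ih (a := ⁅f, ⁅e, a⁆⁆ - (k * (ν + k + 1) : K) • a) (by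
      rw [lie_sub, t.lie_h_lie_f (K := K), hea, lie_smul, lie_smul, ha]
      module) (by
      cases k with
      | zero => simp_all
      | succ k =>
        rw [map_sub, t.pow_succ_e_lie_f, hk', hea, ← add_smul, map_smul, map_smul, lie_zero,
          ← toEnd_apply_apply K L M e a, ← Module.End.mul_apply, ← pow_succ]
        push_cast
        module)
    have hne : (k * (ν + k + 1) + ν : K) ≠ 0 := by
      norm_cast
      omega
    refine ⟨(k * (ν + k + 1) + ν : K)⁻¹ • (⁅f, a⁆ - b), ?_, ?_⟩
    · rw [lie_smul, lie_sub, hb, t.lie_e_lie_f, ha, inv_smul_eq_iff₀ hne]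
      module
    · rw [lie_smul, lie_sub, hfa, hb']
      module

variable [FiniteDimensional K M]

variable (K M) in
lemma isNilpotent_toEnd_e (t : IsSl2Triple h e f) : IsNilpotent (toEnd K L M e) := by
  by_contra hn
  simp only [_root_.IsNilpotent, not_exists] at hn
  let D : End K (End K M) :=
    LinearMap.mulLeft K (toEnd K L M h) - LinearMap.mulRight K (toEnd K L M h)
  have hD (k : ℕ) : D.HasEigenvalue (2 * k : K) := by
    refine End.hasEigenvalue_of_hasEigenvector (x := toEnd K L M e ^ k)
      ⟨End.mem_eigenspace_iff.mpr ?_, hn k⟩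
    ext m
    simp [D, t.lie_h_pow_e (K := K)]
  refine Set.infinite_of_injective_forall_mem (f := fun k : ℕ ↦ (2 * k : K)) (fun a b hab ↦ ?_) hD
    D.finite_hasEigenvalue
  simpa using hab

variable (K M) in
lemma isNilpotent_toEnd_f (t : IsSl2Triple h e f) : IsNilpotent (toEnd K L M f) :=
  t.symm.isNilpotent_toEnd_e K M

lemma eq_zero_of_lie_e_eq_zero (t : IsSl2Triple h e f) {m : M} {μ : K}
    (hμ : ∀ k : ℕ, μ ≠ k) (he : ⁅e, m⁆ = 0) (hh : ⁅h, m⁆ = μ • m) : m = 0 := by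
  obtain ⟨N, hN⟩ := t.isNilpotent_toEnd_f K M
  simpa using t.pow_f_eq_zero_of_lie_e_eq_zero (n := 0) N.zero_le (fun k _ _ ↦ hμ k) he hh
    (by rw [hN, LinearMap.zero_apply])

lemma pow_succ_f_eq_zero_of_lie_e_eq_zero (t : IsSl2Triple h e f) {m : M} {n : ℕ}
    (he : ⁅e, m⁆ = 0) (hh : ⁅h, m⁆ = (n : K) • m) : (toEnd K L M f ^ (n + 1)) m = 0 := by
  obtain ⟨N, hN⟩ := t.isNilpotent_toEnd_f K M
  refine t.pow_f_eq_zero_of_lie_e_eq_zero (N := n + 1 + N) (by omega) (fun k hk _ ↦ ?_) he hh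
    (by rw [pow_add, hN, mul_zero, LinearMap.zero_apply])
  norm_cast
  omega

/-- A generalized eigenvector of `h` of rank two annihilated by `e` is an eigenvector. -/
lemma eq_zero_of_lie_e_of_lie_h_eq_smul_add (t : IsSl2Triple h e f) {u w : M} {n : ℕ}
    (hew : ⁅e, w⁆ = 0) (heu : ⁅e, u⁆ = 0)
    (hw : ⁅h, w⁆ = (n : K) • w + u) (hu : ⁅h, u⁆ = (n : K) • u) : u = 0 := by
  have hfu := t.pow_succ_f_eq_zero_of_lie_e_eq_zero heu hu
  obtain ⟨N, hN⟩ := t.isNilpotent_toEnd_f K M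
  have hfw : (toEnd K L M f ^ (n + 1)) w = 0 := by
    refine pow_f_eq_zero_of_forall_lie_e (e := e) (N := n + 1 + N)
      (c := fun k ↦ (k + 1 : K) * (n - k)) (by omega) (fun k hk _ ↦
        mul_ne_zero (Nat.cast_add_one_ne_zero k) (sub_ne_zero.mpr ?_)) (fun k hk _ ↦ ?_)
      (by rw [pow_add, hN, mul_zero, LinearMap.zero_apply])
    · norm_cast
      omega
    · obtain ⟨j, rfl⟩ := Nat.exists_eq_add_of_le' hk
      rw [t.lie_e_pow_succ_f hew, hw, map_sub, map_add, pow_add _ j, Module.End.mul_apply _ _ u,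
        hfu, map_zero, map_smul, map_smul]
      module
  have hfnu : (toEnd K L M f ^ n) u = 0 := by
    have := t.lie_e_pow_succ_f (K := K) hew n
    rw [hfw, lie_zero, hw, add_sub_cancel_left, eq_comm, smul_eq_zero] at this
    exact this.resolve_left (Nat.cast_add_one_ne_zero n)
  simpa using t.pow_f_eq_zero_of_lie_e_eq_zero (n := 0) n.zero_le
    (fun k _ hk ↦ by norm_cast; omega) heu hu hfnu

variable (K M) in
/-- In a finite-dimensional representation, `h` has no nontrivial Jordan blocks. -/
lemma eq_zero_of_lie_h_eq_smul_add (t : IsSl2Triple h e f) {u w : M} {μ : K}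
    (hw : ⁅h, w⁆ = μ • w + u) (hu : ⁅h, u⁆ = μ • u) : u = 0 := by
  obtain ⟨N, hN⟩ := t.isNilpotent_toEnd_e K M
  have hk : (toEnd K L M e ^ N) w = 0 := by rw [hN, LinearMap.zero_apply]
  clear hN
  induction N generalizing u w μ with
  | zero =>
    obtain rfl : w = 0 := by simpa using hk
    simpa [eq_comm] using hw
  | succ k ih =>
    have hk' : (toEnd K L M e ^ k) ⁅e, w⁆ = 0 := by
      rwa [← toEnd_apply_apply K, ← Module.End.mul_apply, ← pow_succ]
    have heu : ⁅e, u⁆ = 0 := by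
      refine ih (w := ⁅e, w⁆) (μ := μ + 2) ?_ ?_ hk'
      · rw [t.lie_h_lie_e (K := K), hw, lie_add, lie_smul]
        module
      · rw [t.lie_h_lie_e (K := K), hu, lie_smul]
        module
    by_cases hμ : ∃ n : ℕ, μ = n
    · obtain ⟨n, rfl⟩ := hμ
      obtain ⟨b, hb, hb'⟩ := t.exists_lie_e_eq (K := K) (ν := n + 2) (by omega) k (a := ⁅e, w⁆) (by
        rw [t.lie_h_lie_e (K := K), hw, lie_add, heu, lie_smul]
        push_cast
        module) hk'
      refine t.eq_zero_of_lie_e_of_lie_h_eq_smul_add (w := w - b) (by rw [lie_sub, hb, sub_self]) heu ?_ hu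
      rw [lie_sub, hb', hw]
      push_cast
      module
    · push Not at hμ
      exact t.eq_zero_of_lie_e_eq_zero hμ heu hu

variable (K M) in
lemma isCompl_ker_range_toEnd_h_sub (t : IsSl2Triple h e f) (μ : K) :
    IsCompl (LinearMap.ker (toEnd K L M h - algebraMap K _ μ))
      (LinearMap.range (toEnd K L M h - algebraMap K _ μ)) := by
  refine (Submodule.isCompl_iff_disjoint _ _ ?_).mpr ?_
  · rw [add_comm, LinearMap.finrank_range_add_finrank_ker]
  · rw [Submodule.disjoint_def]
    rintro _ hu ⟨w, rfl⟩
    refine t.eq_zero_of_lie_h_eq_smul_add K M (w := w) (μ := μ) ?_ ?_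
    · simp
    · simpa [sub_eq_zero] using hu

end IsSl2Triple


/-- Let `(e, h, f)` be an `sl₂`-triple in a finite-dimensional complex
semisimple Lie algebra `L` with Killing form `κ`.  On the `(-1)`-eigenspace of `ad h`, the
bilinear form `ω(x, y) = κ(e, [x, y])` is skew-symmetric and nondegenerate. -/
theorem stmt_14 (L : Type*) [LieRing L] [LieAlgebra ℂ L] [FiniteDimensional ℂ L]
    [LieAlgebra.IsSemisimple ℂ L] (e h f : L)
    (he : e ≠ 0) (hh : h ≠ 0) (hf : f ≠ 0)
    (h1 : ⁅h, e⁆ = (2 : ℂ) • e) (h2 : ⁅h, f⁆ = (-2 : ℂ) • f) (h3 : ⁅e, f⁆ = h) :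
    (∀ x y : L, ⁅h, x⁆ = -x → ⁅h, y⁆ = -y →
      killingForm ℂ L e ⁅x, y⁆ = -killingForm ℂ L e ⁅y, x⁆) ∧
    (∀ x : L, ⁅h, x⁆ = -x →
      (∀ y : L, ⁅h, y⁆ = -y → killingForm ℂ L e ⁅x, y⁆ = 0) → x = 0) := by
  have t : IsSl2Triple h e f :=
    ⟨hh, h3, by rw [h1, ofNat_smul_eq_nsmul], by rw [h2, neg_smul, ofNat_smul_eq_nsmul]⟩
  refine ⟨fun x y _ _ ↦ by rw [← lie_skew, map_neg], fun x hx hxy ↦ ?_⟩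
  have hz : ⁅h, ⁅e, x⁆⁆ = ⁅e, x⁆ := by
    rw [t.lie_h_lie_e (K := ℂ), hx, lie_neg]
    module
  have hex : ⁅e, x⁆ = 0 := by
    refine LinearMap.ker_eq_bot'.mp (LieAlgebra.IsKilling.ker_killingForm_eq_bot ℂ L) _ ?_
    ext y
    have hy := (t.isCompl_ker_range_toEnd_h_sub ℂ L (-1)).sup_eq_top ▸ Submodule.mem_top (x := y)
    obtain ⟨a, ha, _, ⟨b, rfl⟩, rfl⟩ := Submodule.mem_sup.mp hy
    have ha' : ⁅h, a⁆ = -a := by simpa [add_eq_zero_iff_eq_neg] using ha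
    have hb : killingForm ℂ L ⁅e, x⁆ ⁅h, b⁆ = -killingForm ℂ L ⁅e, x⁆ b := by
      rw [← LieModule.traceForm_apply_lie_apply, ← lie_skew, hz, map_neg, LinearMap.neg_apply]
    have hea : killingForm ℂ L ⁅e, x⁆ a = 0 := by
      rw [LieModule.traceForm_apply_lie_apply, hxy a ha']
    simp [hea, hb]
  refine t.eq_zero_of_lie_e_eq_zero (μ := (-1 : ℂ)) (fun k hk ↦ ?_) hex (by rw [hx, neg_one_smul])
  have := congrArg Complex.re hk
  simp only [Complex.neg_re, Complex.one_re, Complex.natCast_re] at this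
  linarith [Nat.cast_nonneg (α := ℝ) k]
end

section
/- Let g be a finite-dimensional complex semisimple Lie algebra with Killing form κ, and let (e, h, f) be an sl₂-triple in g such that ad h has all eigenvalues in {−2, −1, 0, 1, 2} and g(2) = ℂe, g(−2) = ℂf, where g(m) = {x : [h,x] = m x}. Then k = g(1) ⊕ g(2) is a Lie subalgebra of g with [g(1), g(1)] ⊆ g(2), [k, g(2)] = 0 (so g(2) is contained in the center of k), and the skew-symmetric bilinear form (x, y) ↦ κ(f, [x,y]) on g(1) is nondegenerate; consequently k is a Heisenberg Lie algebra (two-step nilpotent with one-dimensional center g(2) and nondegenerate induced form on g(1)) whenever g(1) ≠ 0. -/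
section WeightVectors

variable {K L : Type*} [Field K] [LieRing L] [LieAlgebra K L]

lemma lie_lie_eq_add_smul {h x y : L} {m n : K} (hx : ⁅h, x⁆ = m • x) (hy : ⁅h, y⁆ = n • y) :
    ⁅h, ⁅x, y⁆⁆ = (m + n) • ⁅x, y⁆ := by
  rw [leibniz_lie, hx, hy, smul_lie, lie_smul, add_smul]

lemma killingForm_eq_zero_of_add_ne_zero {h x y : L} {m n : K} (hx : ⁅h, x⁆ = m • x)
    (hy : ⁅h, y⁆ = n • y) (hmn : m + n ≠ 0) : killingForm K L x y = 0 := by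
  have key := LieModule.traceForm_apply_lie_apply K L L x h y
  rw [← lie_skew, hx, hy] at key
  simp only [map_neg, map_smul, LinearMap.neg_apply, LinearMap.smul_apply, smul_eq_mul] at key
  refine (mul_eq_zero.mp ?_).resolve_left hmn
  change (m + n) * LieModule.traceForm K L L x y = 0
  linear_combination -key

lemma eq_zero_of_forall_killingForm_eq_zero [FiniteDimensional K L] [LieAlgebra.IsKilling K L]
    {x : L} (hx : ∀ y, killingForm K L x y = 0) : x = 0 := by
  have hker : x ∈ LinearMap.ker (killingForm K L) := LinearMap.ext hx
  simpa using hker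

end WeightVectors


/-- Let `(e, h, f)` be an `sl₂`-triple in a finite-dimensional complex
semisimple Lie algebra `L` inducing the short grading with `g(2) = ℂe`, `g(-2) = ℂf`.
Then `k = g(1) ⊕ g(2)` is a Lie subalgebra with `[g(1), g(1)] ⊆ g(2) = ℂe` and
`[k, g(2)] = 0`, and the skew-symmetric form `(x, y) ↦ κ(f, [x, y])` is nondegenerate on
`g(1)`; hence `k` is a Heisenberg Lie algebra whenever `g(1) ≠ 0`. -/
theorem stmt_16 (L : Type*) [LieRing L] [LieAlgebra ℂ L] [FiniteDimensional ℂ L]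
    [LieAlgebra.IsSemisimple ℂ L] (e h f : L)
    (he : e ≠ 0) (hh : h ≠ 0) (hf : f ≠ 0)
    (h1 : ⁅h, e⁆ = (2 : ℂ) • e) (h2 : ⁅h, f⁆ = (-2 : ℂ) • f) (h3 : ⁅e, f⁆ = h)
    (hdec : ∀ x : L, ∃ a b c d e' : L, x = a + b + c + d + e' ∧
      ⁅h, a⁆ = (-2 : ℂ) • a ∧ ⁅h, b⁆ = -b ∧ ⁅h, c⁆ = 0 ∧ ⁅h, d⁆ = d ∧
      ⁅h, e'⁆ = (2 : ℂ) • e')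
    (hg2 : ∀ x : L, ⁅h, x⁆ = (2 : ℂ) • x → ∃ c : ℂ, x = c • e)
    (hgm2 : ∀ x : L, ⁅h, x⁆ = (-2 : ℂ) • x → ∃ c : ℂ, x = c • f) :
    -- [g(1), g(1)] ⊆ g(2) = ℂ e
    (∀ x y : L, ⁅h, x⁆ = x → ⁅h, y⁆ = y → ∃ c : ℂ, ⁅x, y⁆ = c • e) ∧
    -- [k, g(2)] = 0, i.e. g(2) = ℂe is central in k = g(1) ⊕ g(2)
    (∀ x : L, ⁅h, x⁆ = x → ⁅x, e⁆ = 0) ∧ ⁅e, e⁆ = 0 ∧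
    -- the form (x, y) ↦ κ(f, [x, y]) is skew-symmetric on g(1) …
    (∀ x y : L, ⁅h, x⁆ = x → ⁅h, y⁆ = y →
      killingForm ℂ L f ⁅x, y⁆ = -killingForm ℂ L f ⁅y, x⁆) ∧
    -- … and nondegenerate on g(1)
    (∀ x : L, ⁅h, x⁆ = x →
      (∀ y : L, ⁅h, y⁆ = y → killingForm ℂ L f ⁅x, y⁆ = 0) → x = 0) := by
  have orth {x : L} {m : ℂ} (hx : ⁅h, x⁆ = m • x) (hm0 : m ≠ 2) (hm1 : m ≠ 0) (hm2 : m ≠ 1)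
      (hm3 : m ≠ -2) (hone : ∀ y : L, ⁅h, y⁆ = y → killingForm ℂ L x y = 0) : x = 0 := by
    refine eq_zero_of_forall_killingForm_eq_zero (K := ℂ) fun y ↦ ?_
    obtain ⟨a, b, c, d, e', rfl, ha, hb, hc, hd, he'⟩ := hdec y
    have hb' : ⁅h, b⁆ = (-1 : ℂ) • b := by simpa using hb
    have hc' : ⁅h, c⁆ = (0 : ℂ) • c := by simpa using hc
    simp only [map_add]
    rw [killingForm_eq_zero_of_add_ne_zero hx ha fun H ↦ hm0 (by linear_combination H),
      killingForm_eq_zero_of_add_ne_zero hx hb' fun H ↦ hm2 (by linear_combination H),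
      killingForm_eq_zero_of_add_ne_zero hx hc' fun H ↦ hm1 (by linear_combination H),
      hone d hd,
      killingForm_eq_zero_of_add_ne_zero hx he' fun H ↦ hm3 (by linear_combination H)]
    simp
  have weight_one {x : L} (hx : ⁅h, x⁆ = x) : ⁅h, x⁆ = (1 : ℂ) • x := by rw [hx, one_smul]
  have lie_e {x : L} (hx : ⁅h, x⁆ = x) : ⁅x, e⁆ = 0 := by
    have hxe := lie_lie_eq_add_smul (weight_one hx) h1
    refine orth hxe (by norm_num) (by norm_num) (by norm_num) (by norm_num) fun y hy ↦ ?_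
    exact killingForm_eq_zero_of_add_ne_zero hxe (weight_one hy) (by norm_num)
  refine ⟨fun x y hx hy ↦ hg2 _ ?_, fun x hx ↦ lie_e hx, lie_self e, fun x y _ _ ↦ ?_,
    fun x hx hxy ↦ ?_⟩
  · rw [lie_lie_eq_add_smul (weight_one hx) (weight_one hy), one_add_one_eq_two]
  · rw [← lie_skew, map_neg]
  · have hfx : ⁅f, x⁆ = 0 := by
      refine orth (lie_lie_eq_add_smul h2 (weight_one hx)) (by norm_num) (by norm_num)
        (by norm_num) (by norm_num) fun y hy ↦ ?_
      exact (LieModule.traceForm_apply_lie_apply ℂ L L f x y).trans (hxy y hy)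
    have hex : ⁅e, x⁆ = 0 := by rw [← lie_skew, lie_e hx, neg_zero]
    rw [← hx, ← h3, lie_lie, hfx, hex, lie_zero, lie_zero, sub_zero]
end
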